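/- arXiv:1811.00273 — 11 statements merged into one kernel-verified Lean document; each statement's English description precedes it below -/
import Mathlib

section
/- For every matching μ : D → K, the full-power sum rate of the D2D pairs is strictly lower bounded by the sum of the matching gains plus an explicit constant: Σ_{d∈D} ln(1 + γ_d(μ)) > Σ_{d∈D} φ_d(μ) + |D|·(1 + ln(w·n0) − w·n0), where γ_d(μ) = P_m·g^{μ(d)}_{d,d} / (n0 + q·g^{μ(d)}_d + Σ_{i : i≠d, μ(i)=μ(d)} P_m·g^{μ(d)}_{i,d}) is the SINR of pair d when every D2D transmitter uses power P_m, and φ_d(μ) = ln(P_m·g^{μ(d)}_{d,d}/n0) − w·q·g^{μ(d)}_d − Σ_{i : i≠d, μ(i)=μ(d)} (w/2)·P_m·(g^{μ(d)}_{d,i} + g^{μ(d)}_{i,d}). -/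
open Finset Real

/-- The tangent bound `log (w * I) ≤ w * I - 1` linearizes the
interference term of the rate `log (1 + S / I)`. -/
lemma log_one_add_div_gt {S I n w : ℝ} (hS : 0 < S) (hI : 0 < I) (hn : 0 < n) (hw : 0 < w) :
    Real.log (S / n) - w * (I - n) + (1 + Real.log (w * n) - w * n) < Real.log (1 + S / I) := by
  have h1 : Real.log (S / I) < Real.log (1 + S / I) :=
    Real.log_lt_log (by positivity) (by linarith)
  have h2 : Real.log (w * I) ≤ w * I - 1 := Real.log_le_sub_one_of_pos (by positivity)
  rw [Real.log_div hS.ne' hI.ne'] at h1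
  rw [Real.log_mul hw.ne' hI.ne'] at h2
  rw [Real.log_div hS.ne' hn.ne', Real.log_mul hw.ne' hn.ne']
  linarith

/-- Swapping the two members of each ordered co-channel pair does not change the total gain. -/
lemma sum_cochannel_swap {D K : Type*} [Fintype D] [DecidableEq D] [DecidableEq K]
    (g : K → D → D → ℝ) (μ : D → K) :
    ∑ d : D, ∑ i ∈ univ.filter (fun i => i ≠ d ∧ μ i = μ d), g (μ d) d i =
      ∑ d : D, ∑ i ∈ univ.filter (fun i => i ≠ d ∧ μ i = μ d), g (μ d) i d := by
  simp only [Finset.sum_filter]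
  rw [Finset.sum_comm]
  refine Finset.sum_congr rfl fun d _ => Finset.sum_congr rfl fun i _ => ?_
  by_cases h : i ≠ d ∧ μ i = μ d
  · rw [if_pos h, if_pos ⟨h.1.symm, h.2.symm⟩, h.2]
  · rw [if_neg h, if_neg fun h' => h ⟨h'.1.symm, h'.2.symm⟩]

/-- Averaging the gains over both directions preserves the total co-channel interference. -/
lemma sum_cochannel_symm {D K : Type*} [Fintype D] [DecidableEq D] [DecidableEq K]
    (g : K → D → D → ℝ) (μ : D → K) (w P : ℝ) :
    ∑ d : D, ∑ i ∈ univ.filter (fun i => i ≠ d ∧ μ i = μ d),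
        (w / 2) * P * (g (μ d) d i + g (μ d) i d) =
      ∑ d : D, w * ∑ i ∈ univ.filter (fun i => i ≠ d ∧ μ i = μ d), P * g (μ d) i d := by
  simp only [← Finset.mul_sum, Finset.sum_add_distrib, sum_cochannel_swap g μ]
  ring

/-- For every matching `μ : D → K`, the full-power sum rate of the D2D
pairs is strictly lower bounded by the sum of the matching gains plus the explicit
constant `|D| * (1 + ln (w * n0) - w * n0)`. -/
theorem sum_rate_gt_sum_gain_add_const
    {D K : Type*} [Fintype D] [Fintype K] [DecidableEq D] [DecidableEq K]
    [Nonempty D] [Nonempty K]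
    (Pm n0 w q : ℝ) (g : K → D → D → ℝ) (gc : K → D → ℝ)
    (hPm : 0 < Pm) (hn0 : 0 < n0) (hw : 0 < w) (hq : 0 ≤ q)
    (hg : ∀ k i j, 0 ≤ g k i j) (hgdiag : ∀ k d, 0 < g k d d)
    (hgc : ∀ k d, 0 ≤ gc k d)
    (μ : D → K) :
    ∑ d : D, Real.log (1 + Pm * g (μ d) d d /
        (n0 + q * gc (μ d) d +
          ∑ i ∈ univ.filter (fun i => i ≠ d ∧ μ i = μ d), Pm * g (μ d) i d)) >
    (∑ d : D, (Real.log (Pm * g (μ d) d d / n0) - w * q * gc (μ d) d -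
        ∑ i ∈ univ.filter (fun i => i ≠ d ∧ μ i = μ d),
          (w / 2) * Pm * (g (μ d) d i + g (μ d) i d)))
      + (Fintype.card D : ℝ) * (1 + Real.log (w * n0) - w * n0) := by
  let T : D → ℝ := fun d =>
    ∑ i ∈ univ.filter (fun i => i ≠ d ∧ μ i = μ d), Pm * g (μ d) i d
  have hT : ∀ d, 0 ≤ T d := fun d =>
    Finset.sum_nonneg fun i _ => mul_nonneg hPm.le (hg _ _ _)
  have hsum : ∑ d : D, (Real.log (Pm * g (μ d) d d / n0) -
      w * ((n0 + q * gc (μ d) d + T d) - n0) + (1 + Real.log (w * n0) - w * n0)) <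
      ∑ d : D, Real.log (1 + Pm * g (μ d) d d / (n0 + q * gc (μ d) d + T d)) := by
    refine Finset.sum_lt_sum_of_nonempty univ_nonempty fun d _ => ?_
    have hI : 0 < n0 + q * gc (μ d) d + T d := by
      linarith [mul_nonneg hq (hgc (μ d) d), hT d]
    exact log_one_add_div_gt (mul_pos hPm (hgdiag _ _)) hI hn0 hw
  refine lt_of_eq_of_lt ?_ hsum
  rw [Finset.sum_sub_distrib, sum_cochannel_symm g μ w Pm, ← Finset.sum_sub_distrib,
    Finset.sum_add_distrib, Finset.sum_const, Finset.card_univ, nsmul_eq_mul]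
  congr 1
  refine Finset.sum_congr rfl fun d _ => ?_
  simp only [T]
  ring
end

section
/- Let μ : D → K be a matching, let s, t ∈ D with s ≠ t and μ(s) = m ≠ n = μ(t), and let μ' = μ^s_t be the swap-matching. Then the change in the potential equals the total change in the utilities of the four players involved in the swap: Φ(μ') − Φ(μ) = (U_m(μ') + U_n(μ') + U_s(μ') + U_t(μ')) − (U_m(μ) + U_n(μ) + U_s(μ) + U_t(μ)). -/
open Finset Real

/-- Utility of D2D pair `d` under matching `μ` (equation (4)-(5) of the paper). -/
noncomputable def Ud {D K : Type*} [Fintype D] [DecidableEq D] [DecidableEq K]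
    (Pm n0 w q ξ1 θ : ℝ) (g : K → D → D → ℝ) (gc : K → D → ℝ)
    (μ : D → K) (d : D) : ℝ :=
  ξ1 * (Real.log (Pm * g (μ d) d d / n0) - w * q * gc (μ d) d -
      ∑ i ∈ univ.filter (fun i => i ≠ d ∧ μ i = μ d),
        (w / 2) * Pm * (g (μ d) d i + g (μ d) i d)) - θ

/-- Utility of channel `k` under matching `μ` (equation (6) of the paper). -/
noncomputable def Uch {D K : Type*} [Fintype D] [DecidableEq K]
    (Pm ξ2 θ : ℝ) (h : K → D → ℝ) (Q : K → ℝ) (μ : D → K) (k : K) : ℝ :=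
  θ * ((univ.filter (fun d => μ d = k)).card : ℝ) -
    ξ2 * max 0 (∑ d ∈ univ.filter (fun d => μ d = k), Pm * h k d / Q k - 1)

/-- The potential function `Φ` of the matching game. -/
noncomputable def Phi {D K : Type*} [Fintype D] [Fintype K] [DecidableEq D] [DecidableEq K]
    (Pm n0 w q ξ1 ξ2 : ℝ) (g : K → D → D → ℝ) (gc : K → D → ℝ)
    (h : K → D → ℝ) (Q : K → ℝ) (μ : D → K) : ℝ :=
  (∑ d : D, ξ1 * (Real.log (Pm * g (μ d) d d / n0) - w * q * gc (μ d) d -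
      ∑ i ∈ univ.filter (fun i => i ≠ d ∧ μ i = μ d), (w / 2) * Pm * g (μ d) i d)) -
  ∑ k : K, ξ2 * max 0 (∑ d ∈ univ.filter (fun d => μ d = k), Pm * h k d / Q k - 1)

theorem sum_eq_add_add_sum_erase_erase {D : Type*} [Fintype D] [DecidableEq D] {s t : D}
    (hst : s ≠ t) (f : D → ℝ) :
    ∑ d, f d = f s + f t + ∑ d ∈ (univ.erase s).erase t, f d := by
  rw [← add_sum_erase univ f (mem_univ s),
    ← add_sum_erase (univ.erase s) f (mem_erase.2 ⟨hst.symm, mem_univ t⟩), add_assoc]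

/-- A double sum splits into the row and column sums of two indices and the sum over the remaining
pairs, when the four entries with both indices among the two vanish. -/
theorem sum_sum_eq_row_add_col {D : Type*} [Fintype D] [DecidableEq D] {s t : D}
    (hst : s ≠ t) (F : D → D → ℝ) (hss : F s s = 0) (htt : F t t = 0) (hst0 : F s t = 0)
    (hts0 : F t s = 0) :
    ∑ d, ∑ i, F d i = ∑ i, (F s i + F i s) + ∑ i, (F t i + F i t) +
      ∑ d ∈ (univ.erase s).erase t, ∑ i ∈ (univ.erase s).erase t, F d i := by
  simp only [sum_eq_add_add_sum_erase_erase hst, sum_add_distrib, hss, htt, hst0, hts0]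
  ring

/-- For two D2D pairs on different channels, the potential is the sum of their utilities (without
the price `θ`) and a term which depends only on the channels of the other pairs, minus the total
interference cost of the channels. -/
theorem Phi_eq_Ud_add_Ud_add {D K : Type*} [Fintype D] [Fintype K] [DecidableEq D] [DecidableEq K]
    (Pm n0 w q ξ1 ξ2 θ : ℝ) (g : K → D → D → ℝ) (gc : K → D → ℝ)
    (h : K → D → ℝ) (Q : K → ℝ) (μ : D → K) {s t : D} (hst : s ≠ t) (hμ : μ s ≠ μ t) :
    Phi Pm n0 w q ξ1 ξ2 g gc h Q μ =
      Ud Pm n0 w q ξ1 θ g gc μ s + Ud Pm n0 w q ξ1 θ g gc μ t + 2 * θ +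
      ∑ d ∈ (univ.erase s).erase t, ξ1 * (Real.log (Pm * g (μ d) d d / n0) - w * q * gc (μ d) d -
        ∑ i ∈ (univ.erase s).erase t,
          if i ≠ d ∧ μ i = μ d then (w / 2) * Pm * g (μ d) i d else 0) -
      ∑ k : K, ξ2 * max 0 (∑ d ∈ univ.filter (fun d => μ d = k), Pm * h k d / Q k - 1) := by
  have key := sum_sum_eq_row_add_col hst
    (fun d i => if i ≠ d ∧ μ i = μ d then (w / 2) * Pm * g (μ d) i d else 0)
    (by simp) (by simp) (by simp [hμ.symm]) (by simp [hμ])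
  have inter (x : D) : ∑ i ∈ univ.filter (fun i => i ≠ x ∧ μ i = μ x),
        (w / 2) * Pm * (g (μ x) x i + g (μ x) i x) =
      ∑ i, ((if i ≠ x ∧ μ i = μ x then (w / 2) * Pm * g (μ x) i x else 0) +
        (if x ≠ i ∧ μ x = μ i then (w / 2) * Pm * g (μ i) x i else 0)) := by
    rw [sum_filter]
    refine sum_congr rfl fun i _ => ?_
    by_cases hi : i ≠ x ∧ μ i = μ x
    · rw [if_pos hi, if_pos hi, if_pos ⟨hi.1.symm, hi.2.symm⟩, hi.2]
      ring
    · rw [if_neg hi, if_neg hi, if_neg fun h' => hi ⟨h'.1.symm, h'.2.symm⟩, add_zero]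
  have base := sum_eq_add_add_sum_erase_erase hst
    (fun d => Real.log (Pm * g (μ d) d d / n0) - w * q * gc (μ d) d)
  simp only [Phi, Ud, inter, sum_filter _ (fun d => (w / 2) * Pm * g _ d _)]
  simp only [← mul_sum, sum_sub_distrib _ (fun d => ∑ i, _), sum_sub_distrib] at key base ⊢
  linear_combination ξ1 * base - ξ1 * key

theorem card_filter_comp_perm {D K : Type*} [Fintype D] [DecidableEq K] (μ : D → K)
    (e : Equiv.Perm D) (k : K) :
    (univ.filter (fun d => μ (e d) = k)).card = (univ.filter (fun d => μ d = k)).card :=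
  card_equiv e (by simp)

/-- the change in the potential under a swap-matching equals the total
change in the utilities of the four players (two channels, two D2D pairs) involved. -/
theorem potential_diff_eq_utility_diff_swap
    {D K : Type*} [Fintype D] [Fintype K] [DecidableEq D] [DecidableEq K]
    [Nonempty D] [Nonempty K]
    (Pm n0 w q ξ1 ξ2 θ : ℝ) (g : K → D → D → ℝ) (gc : K → D → ℝ)
    (h : K → D → ℝ) (Q : K → ℝ)
    (hPm : 0 < Pm) (hn0 : 0 < n0) (hw : 0 < w) (hq : 0 ≤ q)
    (hξ1 : 0 < ξ1) (hξ2 : 0 ≤ ξ2)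
    (hg : ∀ k i j, 0 ≤ g k i j) (hgdiag : ∀ k d, 0 < g k d d)
    (hgc : ∀ k d, 0 ≤ gc k d) (hh : ∀ k d, 0 ≤ h k d) (hQ : ∀ k, 0 < Q k)
    (μ μ' : D → K) (s t : D) (hst : s ≠ t) (hmn : μ s ≠ μ t)
    (hμ' : ∀ i, μ' i = if i = s then μ t else if i = t then μ s else μ i) :
    Phi Pm n0 w q ξ1 ξ2 g gc h Q μ' - Phi Pm n0 w q ξ1 ξ2 g gc h Q μ =
      (Uch Pm ξ2 θ h Q μ' (μ s) + Uch Pm ξ2 θ h Q μ' (μ t) +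
        Ud Pm n0 w q ξ1 θ g gc μ' s + Ud Pm n0 w q ξ1 θ g gc μ' t) -
      (Uch Pm ξ2 θ h Q μ (μ s) + Uch Pm ξ2 θ h Q μ (μ t) +
        Ud Pm n0 w q ξ1 θ g gc μ s + Ud Pm n0 w q ξ1 θ g gc μ t) := by
  have hs : μ' s = μ t := by simp [hμ']
  have ht : μ' t = μ s := by simp [hμ', hst.symm]
  have hne : ∀ d ∈ (univ.erase s).erase t, μ' d = μ d := fun d hd => by
    simp only [mem_erase] at hd
    rw [hμ', if_neg hd.2.1, if_neg hd.1]
  have hcard (k : K) :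
      (univ.filter (fun d => μ' d = k)).card = (univ.filter (fun d => μ d = k)).card := by
    have hswap (d : D) : μ' d = μ (Equiv.swap s t d) := by
      rw [hμ', Equiv.swap_apply_def]
      split_ifs <;> rfl
    simp only [hswap, card_filter_comp_perm]
  have hrest : ∑ d ∈ (univ.erase s).erase t,
        ξ1 * (Real.log (Pm * g (μ' d) d d / n0) - w * q * gc (μ' d) d -
          ∑ i ∈ (univ.erase s).erase t,
            if i ≠ d ∧ μ' i = μ' d then (w / 2) * Pm * g (μ' d) i d else 0) =
      ∑ d ∈ (univ.erase s).erase t,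
        ξ1 * (Real.log (Pm * g (μ d) d d / n0) - w * q * gc (μ d) d -
          ∑ i ∈ (univ.erase s).erase t,
            if i ≠ d ∧ μ i = μ d then (w / 2) * Pm * g (μ d) i d else 0) := by
    refine sum_congr rfl fun d hd => ?_
    rw [hne d hd]
    congr 2
    exact sum_congr rfl fun i hi => by rw [hne i hi]
  have hpen := Fintype.sum_eq_add (f := fun k =>
      ξ2 * max 0 (∑ d ∈ univ.filter (fun d => μ' d = k), Pm * h k d / Q k - 1) -
      ξ2 * max 0 (∑ d ∈ univ.filter (fun d => μ d = k), Pm * h k d / Q k - 1))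
    (μ s) (μ t) hmn (fun k hk => by
      have : univ.filter (fun d => μ' d = k) = univ.filter (fun d => μ d = k) := by
        ext d
        simp only [mem_filter, hμ']
        split_ifs with h1 h2
        · simp [h1, hk.1.symm, hk.2.symm]
        · simp [h2, hk.1.symm, hk.2.symm]
        · rfl
      simp only [this, sub_self])
  rw [sum_sub_distrib] at hpen
  rw [Phi_eq_Ud_add_Ud_add Pm n0 w q ξ1 ξ2 θ g gc h Q μ hst hmn,
    Phi_eq_Ud_add_Ud_add Pm n0 w q ξ1 ξ2 θ g gc h Q μ' hst (by rw [hs, ht]; exact hmn.symm), hrest]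
  simp only [Uch, hcard]
  linear_combination -hpen
end

section
/- Let μ : D → K be a matching, let s ∈ D, let n ∈ K with n ≠ m = μ(s), and let μ' be the matching with μ'(s) = n and μ'(i) = μ(i) for all i ≠ s (a swap of s with a vacant 'hole' on channel n). Then Φ(μ') − Φ(μ) = (U_m(μ') + U_n(μ') + U_s(μ')) − (U_m(μ) + U_n(μ) + U_s(μ)). -/
open Finset Real

/-- Isolating the pair `s` in the rate part of the potential: its contribution is its own utility
up to the price `θ`, and the rest does not involve the channel of `s`. -/
lemma sum_rate_eq_Ud_add {D K : Type*} [Fintype D] [DecidableEq D] [DecidableEq K]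
    (Pm n0 w q ξ1 θ : ℝ) (g : K → D → D → ℝ) (gc : K → D → ℝ) (μ : D → K) (s : D) :
    (∑ d : D, ξ1 * (Real.log (Pm * g (μ d) d d / n0) - w * q * gc (μ d) d -
        ∑ i ∈ univ.filter (fun i => i ≠ d ∧ μ i = μ d), (w / 2) * Pm * g (μ d) i d)) =
      Ud Pm n0 w q ξ1 θ g gc μ s + θ +
        ∑ d ∈ univ.erase s, ξ1 * (Real.log (Pm * g (μ d) d d / n0) - w * q * gc (μ d) d -
          ∑ i ∈ univ.erase s, if i ≠ d ∧ μ i = μ d then (w / 2) * Pm * g (μ d) i d else 0) := by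
  have hsplit : ∀ d ∈ univ.erase s,
      ξ1 * (Real.log (Pm * g (μ d) d d / n0) - w * q * gc (μ d) d -
        ∑ i ∈ univ.filter (fun i => i ≠ d ∧ μ i = μ d), (w / 2) * Pm * g (μ d) i d) =
      ξ1 * (Real.log (Pm * g (μ d) d d / n0) - w * q * gc (μ d) d -
          ∑ i ∈ univ.erase s, if i ≠ d ∧ μ i = μ d then (w / 2) * Pm * g (μ d) i d else 0) -
        ξ1 * (if d ≠ s ∧ μ d = μ s then (w / 2) * Pm * g (μ s) s d else 0) := by
    intro d hd
    have hds : d ≠ s := ne_of_mem_erase hd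
    rw [sum_filter, ← add_sum_erase univ _ (mem_univ s)]
    by_cases hc : μ d = μ s
    · simp only [hds, hds.symm, hc, ne_eq, not_false_eq_true, and_self, if_true]
      ring
    · simp only [hc, Ne.symm hc, and_false, if_false]
      ring
  have hout : ∑ d ∈ univ.erase s,
      ξ1 * (if d ≠ s ∧ μ d = μ s then (w / 2) * Pm * g (μ s) s d else 0) =
      ξ1 * ∑ i ∈ univ.filter (fun i => i ≠ s ∧ μ i = μ s), (w / 2) * Pm * g (μ s) s i := by
    rw [← mul_sum, sum_filter, ← add_sum_erase univ _ (mem_univ s)]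
    simp
  rw [← add_sum_erase univ _ (mem_univ s), sum_congr rfl hsplit, sum_sub_distrib, hout, Ud]
  simp only [mul_add, sum_add_distrib]
  ring

/-- The total number of pairs on two distinct channels is the number of pairs on either. -/
lemma card_filter_add_card_filter_of_ne {D K : Type*} [Fintype D] [DecidableEq K]
    (μ : D → K) {m n : K} (hmn : m ≠ n) :
    (univ.filter (fun d => μ d = m)).card + (univ.filter (fun d => μ d = n)).card =
      (univ.filter (fun d => μ d = m ∨ μ d = n)).card := by
  classical
  rw [filter_or, card_union_of_disjoint]
  exact disjoint_filter.2 fun d _ h₁ h₂ => hmn (h₁.symm.trans h₂)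

/-- Sums of functions agreeing away from two points differ by the values at these points. -/
lemma sum_sub_sum_eq_of_eq_off_pair {K : Type*} [Fintype K] [DecidableEq K] (F G : K → ℝ)
    {m n : K} (hmn : m ≠ n) (hFG : ∀ k, k ≠ m → k ≠ n → F k = G k) :
    ∑ k, F k - ∑ k, G k = (F m + F n) - (G m + G n) := by
  rw [← sum_sub_distrib, ← sum_subset (subset_univ {m, n}), sum_pair hmn]
  · ring
  · intro k _ hk
    simp only [mem_insert, mem_singleton, not_or] at hk
    rw [hFG k hk.1 hk.2, sub_self]

/-- the change in the potential under a single move of D2D pair `s` to a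
vacant "hole" on channel `n` equals the total change in the utilities of the three
players (two channels, one D2D pair) involved. -/
theorem potential_diff_eq_utility_diff_hole_swap
    {D K : Type*} [Fintype D] [Fintype K] [DecidableEq D] [DecidableEq K]
    [Nonempty D] [Nonempty K]
    (Pm n0 w q ξ1 ξ2 θ : ℝ) (g : K → D → D → ℝ) (gc : K → D → ℝ)
    (h : K → D → ℝ) (Q : K → ℝ)
    (hPm : 0 < Pm) (hn0 : 0 < n0) (hw : 0 < w) (hq : 0 ≤ q)
    (hξ1 : 0 < ξ1) (hξ2 : 0 ≤ ξ2)
    (hg : ∀ k i j, 0 ≤ g k i j) (hgdiag : ∀ k d, 0 < g k d d)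
    (hgc : ∀ k d, 0 ≤ gc k d) (hh : ∀ k d, 0 ≤ h k d) (hQ : ∀ k, 0 < Q k)
    (μ μ' : D → K) (s : D) (n : K) (hn : n ≠ μ s)
    (hμ' : ∀ i, μ' i = if i = s then n else μ i) :
    Phi Pm n0 w q ξ1 ξ2 g gc h Q μ' - Phi Pm n0 w q ξ1 ξ2 g gc h Q μ =
      (Uch Pm ξ2 θ h Q μ' (μ s) + Uch Pm ξ2 θ h Q μ' n +
        Ud Pm n0 w q ξ1 θ g gc μ' s) -
      (Uch Pm ξ2 θ h Q μ (μ s) + Uch Pm ξ2 θ h Q μ n +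
        Ud Pm n0 w q ξ1 θ g gc μ s) := by
  have hs : μ' s = n := by simp [hμ']
  have hoff : ∀ i, i ≠ s → μ' i = μ i := fun i hi => by simp [hμ', hi]
  have hrest : (∑ d ∈ univ.erase s,
      ξ1 * (Real.log (Pm * g (μ' d) d d / n0) - w * q * gc (μ' d) d -
        ∑ i ∈ univ.erase s, if i ≠ d ∧ μ' i = μ' d then (w / 2) * Pm * g (μ' d) i d else 0)) =
      ∑ d ∈ univ.erase s, ξ1 * (Real.log (Pm * g (μ d) d d / n0) - w * q * gc (μ d) d -
        ∑ i ∈ univ.erase s, if i ≠ d ∧ μ i = μ d then (w / 2) * Pm * g (μ d) i d else 0) := by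
    refine sum_congr rfl fun d hd => ?_
    rw [hoff d (ne_of_mem_erase hd)]
    congr 2
    refine sum_congr rfl fun i hi => ?_
    rw [hoff i (ne_of_mem_erase hi)]
  have hpen := sum_sub_sum_eq_of_eq_off_pair
    (fun k => ξ2 * max 0 (∑ d ∈ univ.filter (fun d => μ' d = k), Pm * h k d / Q k - 1))
    (fun k => ξ2 * max 0 (∑ d ∈ univ.filter (fun d => μ d = k), Pm * h k d / Q k - 1))
    hn.symm fun k hkm hkn => by
      have hset : univ.filter (fun d => μ' d = k) = univ.filter (fun d => μ d = k) := by
        refine filter_congr fun d _ => ?_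
        by_cases hd : d = s
        · subst hd
          simp [hs, hkm.symm, hkn.symm]
        · rw [hoff d hd]
      simp only [hset]
  have hcard : ((univ.filter (fun d => μ' d = μ s)).card : ℝ) +
        (univ.filter (fun d => μ' d = n)).card =
      (univ.filter (fun d => μ d = μ s)).card + (univ.filter (fun d => μ d = n)).card := by
    norm_cast
    rw [card_filter_add_card_filter_of_ne μ' hn.symm, card_filter_add_card_filter_of_ne μ hn.symm]
    congr 1
    refine filter_congr fun d _ => ?_
    by_cases hd : d = s
    · subst hd
      simp [hs]
    · rw [hoff d hd]
  simp only [Phi, Uch, sum_rate_eq_Ud_add Pm n0 w q ξ1 θ g gc _ s, hrest]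
  linear_combination -hpen - θ * hcard
end

section
/- Every 'approved' swap strictly increases the potential function: let μ : D → K be a matching, let s, t ∈ D with s ≠ t and μ(s) = m ≠ n = μ(t), and let μ' = μ^s_t. If U_s(μ') ≥ U_s(μ), U_t(μ') ≥ U_t(μ), and U_m(μ') + U_n(μ') ≥ U_m(μ) + U_n(μ), with at least one of these three inequalities strict, then Φ(μ') > Φ(μ). -/
open Finset Real

theorem Fintype.sum_eq_add_add_sum_compl {D M : Type*} [Fintype D] [DecidableEq D]
    [AddCommMonoid M] {s t : D} (hst : s ≠ t) (f : D → M) :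
    ∑ d, f d = f s + f t + ∑ d ∈ ({s, t} : Finset D)ᶜ, f d := by
  rw [← Finset.sum_add_sum_compl {s, t} f, Finset.sum_pair hst]

/-- A double sum that vanishes on the diagonal and on `(s, t)`, `(t, s)` splits into the terms
involving `s`, the terms involving `t`, and the terms involving neither. -/
theorem sum_sum_eq_of_pair_eq_zero {D M : Type*} [Fintype D] [DecidableEq D] [AddCommMonoid M]
    {s t : D} (hst : s ≠ t) (F : D → D → M) (hdiag : ∀ d, F d d = 0)
    (hF : F s t = 0) (hF' : F t s = 0) :
    ∑ d, ∑ i, F d i = ∑ i, (F s i + F i s) + ∑ i, (F t i + F i t) +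
      ∑ d ∈ ({s, t} : Finset D)ᶜ, ∑ i ∈ ({s, t} : Finset D)ᶜ, F d i := by
  simp only [Fintype.sum_eq_add_add_sum_compl hst, Finset.sum_add_distrib, hdiag, hF, hF']
  abel

/-- The part of the D2D potential not involving the pairs `s` and `t`. -/
noncomputable def residualPotential {D K : Type*} [Fintype D] [DecidableEq D] [DecidableEq K]
    (Pm n0 w q ξ1 : ℝ) (g : K → D → D → ℝ) (gc : K → D → ℝ) (s t : D) (μ : D → K) : ℝ :=
  ξ1 * (∑ d ∈ ({s, t} : Finset D)ᶜ, (Real.log (Pm * g (μ d) d d / n0) - w * q * gc (μ d) d) -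
    ∑ d ∈ ({s, t} : Finset D)ᶜ, ∑ i ∈ ({s, t} : Finset D)ᶜ,
      if i ≠ d ∧ μ i = μ d then (w / 2) * Pm * g (μ d) i d else 0)

theorem residualPotential_congr {D K : Type*} [Fintype D] [DecidableEq D] [DecidableEq K]
    (Pm n0 w q ξ1 : ℝ) (g : K → D → D → ℝ) (gc : K → D → ℝ) {s t : D} {μ μ' : D → K}
    (hμ : ∀ d, d ≠ s → d ≠ t → μ' d = μ d) :
    residualPotential Pm n0 w q ξ1 g gc s t μ' = residualPotential Pm n0 w q ξ1 g gc s t μ := by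
  have hμ_compl : ∀ d ∈ ({s, t} : Finset D)ᶜ, μ' d = μ d := fun d hd => by
    simp only [Finset.mem_compl, Finset.mem_insert, Finset.mem_singleton, not_or] at hd
    exact hμ d hd.1 hd.2
  unfold residualPotential
  congr 2
  · exact Finset.sum_congr rfl fun d hd => by rw [hμ_compl d hd]
  · exact Finset.sum_congr rfl fun d hd => Finset.sum_congr rfl fun i hi => by
      rw [hμ_compl d hd, hμ_compl i hi]

theorem sum_Uch {D K : Type*} [Fintype D] [Fintype K] [DecidableEq K]
    (Pm ξ2 θ : ℝ) (h : K → D → ℝ) (Q : K → ℝ) (μ : D → K) :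
    ∑ k, Uch Pm ξ2 θ h Q μ k = θ * Fintype.card D -
      ∑ k, ξ2 * max 0 (∑ d ∈ univ.filter (fun d => μ d = k), Pm * h k d / Q k - 1) := by
  unfold Uch
  rw [Finset.sum_sub_distrib, ← Finset.mul_sum, ← Nat.cast_sum,
    ← Finset.card_eq_sum_card_fiberwise fun _ _ => Finset.mem_coe.2 (Finset.mem_univ _),
    Finset.card_univ]

theorem Uch_congr {D K : Type*} [Fintype D] [DecidableEq K]
    (Pm ξ2 θ : ℝ) (h : K → D → ℝ) (Q : K → ℝ) {μ μ' : D → K} {k : K}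
    (hμ : ∀ d, μ' d = k ↔ μ d = k) :
    Uch Pm ξ2 θ h Q μ' k = Uch Pm ξ2 θ h Q μ k := by
  simp only [Uch, hμ]

/-- When `s` and `t` use different channels, their utilities and those of the channels account for
the whole potential, up to a term not involving `s` and `t` and a constant. -/
theorem Phi_eq_utilities_add_residual {D K : Type*} [Fintype D] [Fintype K] [DecidableEq D]
    [DecidableEq K] (Pm n0 w q ξ1 ξ2 θ : ℝ) (g : K → D → D → ℝ) (gc : K → D → ℝ)
    (h : K → D → ℝ) (Q : K → ℝ) {μ : D → K} {s t : D} (hμ : μ s ≠ μ t) :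
    Phi Pm n0 w q ξ1 ξ2 g gc h Q μ =
      Ud Pm n0 w q ξ1 θ g gc μ s + Ud Pm n0 w q ξ1 θ g gc μ t + ∑ k, Uch Pm ξ2 θ h Q μ k +
        residualPotential Pm n0 w q ξ1 g gc s t μ + (2 * θ - θ * Fintype.card D) := by
  have hst : s ≠ t := fun e => hμ (e ▸ rfl)
  set F : D → D → ℝ := fun d i =>
    if i ≠ d ∧ μ i = μ d then (w / 2) * Pm * g (μ d) i d else 0 with hF
  have interference (d : D) : ∑ i ∈ univ.filter (fun i => i ≠ d ∧ μ i = μ d),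
      (w / 2) * Pm * (g (μ d) d i + g (μ d) i d) = ∑ i, (F d i + F i d) := by
    rw [Finset.sum_filter]
    refine Finset.sum_congr rfl fun i _ => ?_
    by_cases hi : i ≠ d ∧ μ i = μ d
    · have hi' : d ≠ i ∧ μ d = μ i := ⟨hi.1.symm, hi.2.symm⟩
      simp only [hF, if_pos hi, if_pos hi']
      rw [hi.2]
      ring
    · have hi' : ¬(d ≠ i ∧ μ d = μ i) := fun e => hi ⟨e.1.symm, e.2.symm⟩
      simp only [hF, if_neg hi, if_neg hi', add_zero]
  have split := sum_sum_eq_of_pair_eq_zero hst F (by simp [hF]) (by simp [hF, hμ.symm])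
    (by simp [hF, hμ])
  rw [sum_Uch]
  unfold Phi Ud residualPotential
  simp only [interference]
  rw [← Finset.mul_sum, Finset.sum_sub_distrib]
  simp only [Finset.sum_filter]
  rw [split, Fintype.sum_eq_add_add_sum_compl hst]
  ring

/-- every "approved" swap strictly increases the potential function. -/
theorem approved_swap_increases_potential
    {D K : Type*} [Fintype D] [Fintype K] [DecidableEq D] [DecidableEq K]
    [Nonempty D] [Nonempty K]
    (Pm n0 w q ξ1 ξ2 θ : ℝ) (g : K → D → D → ℝ) (gc : K → D → ℝ)
    (h : K → D → ℝ) (Q : K → ℝ)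
    (hPm : 0 < Pm) (hn0 : 0 < n0) (hw : 0 < w) (hq : 0 ≤ q)
    (hξ1 : 0 < ξ1) (hξ2 : 0 ≤ ξ2)
    (hg : ∀ k i j, 0 ≤ g k i j) (hgdiag : ∀ k d, 0 < g k d d)
    (hgc : ∀ k d, 0 ≤ gc k d) (hh : ∀ k d, 0 ≤ h k d) (hQ : ∀ k, 0 < Q k)
    (μ μ' : D → K) (s t : D) (hst : s ≠ t) (hmn : μ s ≠ μ t)
    (hμ' : ∀ i, μ' i = if i = s then μ t else if i = t then μ s else μ i)
    (hs : Ud Pm n0 w q ξ1 θ g gc μ' s ≥ Ud Pm n0 w q ξ1 θ g gc μ s)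
    (ht : Ud Pm n0 w q ξ1 θ g gc μ' t ≥ Ud Pm n0 w q ξ1 θ g gc μ t)
    (hch : Uch Pm ξ2 θ h Q μ' (μ s) + Uch Pm ξ2 θ h Q μ' (μ t) ≥
           Uch Pm ξ2 θ h Q μ (μ s) + Uch Pm ξ2 θ h Q μ (μ t))
    (hstrict :
      Ud Pm n0 w q ξ1 θ g gc μ' s > Ud Pm n0 w q ξ1 θ g gc μ s ∨
      Ud Pm n0 w q ξ1 θ g gc μ' t > Ud Pm n0 w q ξ1 θ g gc μ t ∨
      Uch Pm ξ2 θ h Q μ' (μ s) + Uch Pm ξ2 θ h Q μ' (μ t) >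
        Uch Pm ξ2 θ h Q μ (μ s) + Uch Pm ξ2 θ h Q μ (μ t)) :
    Phi Pm n0 w q ξ1 ξ2 g gc h Q μ' > Phi Pm n0 w q ξ1 ξ2 g gc h Q μ := by
  have hs' : μ' s = μ t := by simp [hμ']
  have ht' : μ' t = μ s := by simp [hμ', hst.symm]
  have hfix : ∀ d, d ≠ s → d ≠ t → μ' d = μ d := fun d hds hdt => by simp [hμ', hds, hdt]
  have hchannels : ∑ k ∈ ({μ s, μ t} : Finset K)ᶜ, Uch Pm ξ2 θ h Q μ' k =
      ∑ k ∈ ({μ s, μ t} : Finset K)ᶜ, Uch Pm ξ2 θ h Q μ k := by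
    refine Finset.sum_congr rfl fun k hk => Uch_congr Pm ξ2 θ h Q fun d => ?_
    simp only [Finset.mem_compl, Finset.mem_insert, Finset.mem_singleton, not_or] at hk
    grind
  rw [Phi_eq_utilities_add_residual Pm n0 w q ξ1 ξ2 θ g gc h Q hmn,
    Phi_eq_utilities_add_residual Pm n0 w q ξ1 ξ2 θ g gc h Q (μ := μ') (s := s) (t := t)
      (by rw [hs', ht']; exact hmn.symm),
    residualPotential_congr Pm n0 w q ξ1 g gc hfix,
    Fintype.sum_eq_add_add_sum_compl hmn, Fintype.sum_eq_add_add_sum_compl hmn, hchannels]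
  rcases hstrict with hlt | hlt | hlt <;> linarith
end

section
/- A strongly swap-stable matching exists; more precisely, any matching μ* that maximizes the potential Φ over all matchings μ : D → K (such a maximizer exists since D and K are finite and nonempty) is strongly swap-stable. -/
open Finset Real

/-- A matching is strongly swap-stable if no swap of two matched D2D pairs and no move
of a D2D pair to a vacant "hole" is weakly profitable for all involved players and
strictly profitable for at least one of them. -/
def StronglySwapStable {D K : Type*} [Fintype D] [Fintype K] [DecidableEq D] [DecidableEq K]
    (Pm n0 w q ξ1 ξ2 θ : ℝ) (g : K → D → D → ℝ) (gc : K → D → ℝ)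
    (h : K → D → ℝ) (Q : K → ℝ) (μ : D → K) : Prop :=
  (¬ ∃ s t : D, s ≠ t ∧ μ s ≠ μ t ∧
      (let μ' : D → K := fun i => if i = s then μ t else if i = t then μ s else μ i
       Ud Pm n0 w q ξ1 θ g gc μ' s ≥ Ud Pm n0 w q ξ1 θ g gc μ s ∧
       Ud Pm n0 w q ξ1 θ g gc μ' t ≥ Ud Pm n0 w q ξ1 θ g gc μ t ∧
       Uch Pm ξ2 θ h Q μ' (μ s) + Uch Pm ξ2 θ h Q μ' (μ t) ≥
         Uch Pm ξ2 θ h Q μ (μ s) + Uch Pm ξ2 θ h Q μ (μ t) ∧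
       (Ud Pm n0 w q ξ1 θ g gc μ' s > Ud Pm n0 w q ξ1 θ g gc μ s ∨
        Ud Pm n0 w q ξ1 θ g gc μ' t > Ud Pm n0 w q ξ1 θ g gc μ t ∨
        Uch Pm ξ2 θ h Q μ' (μ s) + Uch Pm ξ2 θ h Q μ' (μ t) >
          Uch Pm ξ2 θ h Q μ (μ s) + Uch Pm ξ2 θ h Q μ (μ t)))) ∧
  (¬ ∃ (s : D) (n : K), n ≠ μ s ∧
      (let μ' : D → K := fun i => if i = s then n else μ i
       Ud Pm n0 w q ξ1 θ g gc μ' s ≥ Ud Pm n0 w q ξ1 θ g gc μ s ∧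
       Uch Pm ξ2 θ h Q μ' (μ s) + Uch Pm ξ2 θ h Q μ' n ≥
         Uch Pm ξ2 θ h Q μ (μ s) + Uch Pm ξ2 θ h Q μ n ∧
       (Ud Pm n0 w q ξ1 θ g gc μ' s > Ud Pm n0 w q ξ1 θ g gc μ s ∨
        Uch Pm ξ2 θ h Q μ' (μ s) + Uch Pm ξ2 θ h Q μ' n >
          Uch Pm ξ2 θ h Q μ (μ s) + Uch Pm ξ2 θ h Q μ n)))

/-- For a matrix `x` vanishing on `T × T`, the total sum is the sum of the rows and columns
indexed by `T` plus the sum over the complement of `T`. -/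
theorem sum_sum_eq_sum_add_sum_compl {D : Type*} [Fintype D] [DecidableEq D]
    (T : Finset D) (x : D → D → ℝ) (hx : ∀ i ∈ T, ∀ d ∈ T, x i d = 0) :
    ∑ d, ∑ i, x i d = ∑ d ∈ T, ∑ i, (x d i + x i d) + ∑ d ∈ Tᶜ, ∑ i ∈ Tᶜ, x i d := by
  have hT : ∑ d ∈ T, ∑ i ∈ T, x d i = 0 :=
    Finset.sum_eq_zero fun d hd => Finset.sum_eq_zero fun i hi => hx d hd i hi
  have hrow : ∑ d ∈ T, ∑ i, x d i = ∑ d ∈ Tᶜ, ∑ i ∈ T, x i d := by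
    simp_rw [← Finset.sum_add_sum_compl T (fun i => x _ i), Finset.sum_add_distrib]
    rw [hT, zero_add, Finset.sum_comm]
  have hcompl : ∑ d ∈ Tᶜ, ∑ i, x i d
      = ∑ d ∈ Tᶜ, ∑ i ∈ T, x i d + ∑ d ∈ Tᶜ, ∑ i ∈ Tᶜ, x i d := by
    simp_rw [← Finset.sum_add_distrib, Finset.sum_add_sum_compl]
  rw [← Finset.sum_add_sum_compl T (fun d => ∑ i, x i d), hcompl, ← hrow]
  simp_rw [Finset.sum_add_distrib]
  ring

section

variable {D K : Type*} [Fintype D] [DecidableEq D] [DecidableEq K]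

/-- The part of the potential coming from the D2D pairs. -/
noncomputable def pairPotential (Pm n0 w q ξ1 : ℝ) (g : K → D → D → ℝ) (gc : K → D → ℝ)
    (μ : D → K) : ℝ :=
  ∑ d : D, ξ1 * (Real.log (Pm * g (μ d) d d / n0) - w * q * gc (μ d) d -
      ∑ i ∈ univ.filter (fun i => i ≠ d ∧ μ i = μ d), (w / 2) * Pm * g (μ d) i d)

/-- If the pairs in `T` occupy distinct channels, their utilities account for the whole
dependence of the pair potential on their channels. -/
theorem pairPotential_eq_sum_Ud_add (Pm n0 w q ξ1 θ : ℝ) (g : K → D → D → ℝ)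
    (gc : K → D → ℝ) (μ : D → K) (T : Finset D) (hμ : Set.InjOn μ T) :
    pairPotential Pm n0 w q ξ1 g gc μ = ∑ d ∈ T, (Ud Pm n0 w q ξ1 θ g gc μ d + θ) +
      ∑ d ∈ Tᶜ, ξ1 * (Real.log (Pm * g (μ d) d d / n0) - w * q * gc (μ d) d -
        ∑ i ∈ Tᶜ, if i ≠ d ∧ μ i = μ d then (w / 2) * Pm * g (μ d) i d else 0) := by
  have hsum := sum_sum_eq_sum_add_sum_compl T
    (fun i d => if i ≠ d ∧ μ i = μ d then (w / 2) * Pm * g (μ d) i d else 0)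
    (fun i hi d hd => if_neg fun hid => hid.1 (hμ hi hd hid.2))
  have hUd : ∀ d, Ud Pm n0 w q ξ1 θ g gc μ d + θ =
      ξ1 * (Real.log (Pm * g (μ d) d d / n0) - w * q * gc (μ d) d) -
        ξ1 * ∑ i, ((if d ≠ i ∧ μ d = μ i then (w / 2) * Pm * g (μ i) d i else 0) +
          if i ≠ d ∧ μ i = μ d then (w / 2) * Pm * g (μ d) i d else 0) := by
    intro d
    have hint : ∑ i ∈ univ.filter (fun i => i ≠ d ∧ μ i = μ d),
        (w / 2) * Pm * (g (μ d) d i + g (μ d) i d) =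
        ∑ i, ((if d ≠ i ∧ μ d = μ i then (w / 2) * Pm * g (μ i) d i else 0) +
          if i ≠ d ∧ μ i = μ d then (w / 2) * Pm * g (μ d) i d else 0) := by
      rw [Finset.sum_filter]
      refine Finset.sum_congr rfl fun i _ => ?_
      by_cases hi : i ≠ d ∧ μ i = μ d
      · rw [if_pos hi, if_pos hi, if_pos ⟨hi.1.symm, hi.2.symm⟩, hi.2]
        ring
      · rw [if_neg hi, if_neg hi, if_neg fun hd => hi ⟨hd.1.symm, hd.2.symm⟩, add_zero]
    rw [Ud, hint]
    ring
  have hsplit := Finset.sum_add_sum_compl T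
    (fun d => Real.log (Pm * g (μ d) d d / n0) - w * q * gc (μ d) d)
  simp only [Finset.sum_sub_distrib] at hsplit
  simp only [hUd, pairPotential, Finset.sum_filter, ← mul_sub ξ1, ← Finset.mul_sum _ _ ξ1,
    Finset.sum_sub_distrib]
  linear_combination -ξ1 * hsplit - ξ1 * hsum

/-- Reassigning a set of pairs, occupying distinct channels before and after, changes the pair
potential by the total change of their utilities. -/
theorem pairPotential_sub (Pm n0 w q ξ1 θ : ℝ) (g : K → D → D → ℝ) (gc : K → D → ℝ)
    (μ μ' : D → K) (T : Finset D) (hμ : Set.InjOn μ T) (hμ' : Set.InjOn μ' T)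
    (heq : ∀ d ∉ T, μ' d = μ d) :
    pairPotential Pm n0 w q ξ1 g gc μ' - pairPotential Pm n0 w q ξ1 g gc μ =
      ∑ d ∈ T, (Ud Pm n0 w q ξ1 θ g gc μ' d - Ud Pm n0 w q ξ1 θ g gc μ d) := by
  have hrest : ∑ d ∈ Tᶜ, ξ1 * (Real.log (Pm * g (μ' d) d d / n0) - w * q * gc (μ' d) d -
        ∑ i ∈ Tᶜ, if i ≠ d ∧ μ' i = μ' d then (w / 2) * Pm * g (μ' d) i d else 0) =
      ∑ d ∈ Tᶜ, ξ1 * (Real.log (Pm * g (μ d) d d / n0) - w * q * gc (μ d) d -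
        ∑ i ∈ Tᶜ, if i ≠ d ∧ μ i = μ d then (w / 2) * Pm * g (μ d) i d else 0) := by
    refine Finset.sum_congr rfl fun d hd => ?_
    rw [heq d (Finset.mem_compl.1 hd)]
    congr 2
    refine Finset.sum_congr rfl fun i hi => ?_
    rw [heq i (Finset.mem_compl.1 hi)]
  rw [pairPotential_eq_sum_Ud_add Pm n0 w q ξ1 θ g gc μ T hμ,
    pairPotential_eq_sum_Ud_add Pm n0 w q ξ1 θ g gc μ' T hμ', hrest]
  simp_rw [Finset.sum_add_distrib, Finset.sum_sub_distrib]
  ring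

variable [Fintype K]

theorem Phi_eq_pairPotential_add_sum_Uch (Pm n0 w q ξ1 ξ2 θ : ℝ) (g : K → D → D → ℝ)
    (gc : K → D → ℝ) (h : K → D → ℝ) (Q : K → ℝ) (μ : D → K) :
    Phi Pm n0 w q ξ1 ξ2 g gc h Q μ = pairPotential Pm n0 w q ξ1 g gc μ +
      ∑ k, Uch Pm ξ2 θ h Q μ k - θ * Fintype.card D := by
  have hcard : ∑ k, ((univ.filter (fun d => μ d = k)).card : ℝ) = Fintype.card D := by
    rw [← Finset.card_univ]
    exact_mod_cast (Finset.card_eq_sum_card_fiberwise (f := μ) (s := univ) (t := univ)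
      (fun _ _ => Finset.mem_coe.2 (Finset.mem_univ _))).symm
  simp only [Phi, pairPotential, Uch, Finset.sum_sub_distrib, ← Finset.mul_sum, hcard]
  ring

/-- The change of the potential under a reassignment of the pairs in `T` within the channels
in `C` is the total change of the utilities of `T` and `C`. -/
theorem Phi_sub (Pm n0 w q ξ1 ξ2 θ : ℝ) (g : K → D → D → ℝ)
    (gc : K → D → ℝ) (h : K → D → ℝ) (Q : K → ℝ) (μ μ' : D → K) (T : Finset D)
    (C : Finset K) (hμ : Set.InjOn μ T) (hμ' : Set.InjOn μ' T) (heq : ∀ d ∉ T, μ' d = μ d)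
    (hC : ∀ d ∈ T, μ d ∈ C) (hC' : ∀ d ∈ T, μ' d ∈ C) :
    Phi Pm n0 w q ξ1 ξ2 g gc h Q μ' - Phi Pm n0 w q ξ1 ξ2 g gc h Q μ =
      ∑ d ∈ T, (Ud Pm n0 w q ξ1 θ g gc μ' d - Ud Pm n0 w q ξ1 θ g gc μ d) +
      ∑ k ∈ C, (Uch Pm ξ2 θ h Q μ' k - Uch Pm ξ2 θ h Q μ k) := by
  have hUch : ∑ k ∈ C, (Uch Pm ξ2 θ h Q μ' k - Uch Pm ξ2 θ h Q μ k) =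
      ∑ k, (Uch Pm ξ2 θ h Q μ' k - Uch Pm ξ2 θ h Q μ k) := by
    refine Finset.sum_subset (Finset.subset_univ C) fun k _ hk => ?_
    have hfib : univ.filter (fun d => μ' d = k) = univ.filter (fun d => μ d = k) := by
      refine Finset.filter_congr fun d _ => ?_
      by_cases hd : d ∈ T
      · exact iff_of_false (fun e => hk (e ▸ hC' d hd)) (fun e => hk (e ▸ hC d hd))
      · rw [heq d hd]
    simp only [Uch, hfib, sub_self]
  rw [hUch, ← pairPotential_sub Pm n0 w q ξ1 θ g gc μ μ' T hμ hμ' heq,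
    Phi_eq_pairPotential_add_sum_Uch Pm n0 w q ξ1 ξ2 θ,
    Phi_eq_pairPotential_add_sum_Uch Pm n0 w q ξ1 ξ2 θ, Finset.sum_sub_distrib]
  ring

end

/-- a strongly swap-stable matching exists; more precisely, a maximizer
of the potential `Φ` over matchings exists, and any such maximizer is strongly
swap-stable. -/
theorem exists_stronglySwapStable
    {D K : Type*} [Fintype D] [Fintype K] [DecidableEq D] [DecidableEq K]
    [Nonempty D] [Nonempty K]
    (Pm n0 w q ξ1 ξ2 θ : ℝ) (g : K → D → D → ℝ) (gc : K → D → ℝ)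
    (h : K → D → ℝ) (Q : K → ℝ)
    (hPm : 0 < Pm) (hn0 : 0 < n0) (hw : 0 < w) (hq : 0 ≤ q)
    (hξ1 : 0 < ξ1) (hξ2 : 0 ≤ ξ2)
    (hg : ∀ k i j, 0 ≤ g k i j) (hgdiag : ∀ k d, 0 < g k d d)
    (hgc : ∀ k d, 0 ≤ gc k d) (hh : ∀ k d, 0 ≤ h k d) (hQ : ∀ k, 0 < Q k) :
    (∃ μs : D → K, ∀ μ : D → K,
        Phi Pm n0 w q ξ1 ξ2 g gc h Q μ ≤ Phi Pm n0 w q ξ1 ξ2 g gc h Q μs) ∧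
    (∀ μs : D → K,
        (∀ μ : D → K, Phi Pm n0 w q ξ1 ξ2 g gc h Q μ ≤ Phi Pm n0 w q ξ1 ξ2 g gc h Q μs) →
        StronglySwapStable Pm n0 w q ξ1 ξ2 θ g gc h Q μs) := by
  refine ⟨Finite.exists_max _, fun μ hmax => ⟨?_, ?_⟩⟩
  · rintro ⟨s, t, hst, hμst, hs, ht, hc, hstrict⟩
    set μ' : D → K := fun i => if i = s then μ t else if i = t then μ s else μ i
    have hμ's : μ' s = μ t := if_pos rfl
    have hμ't : μ' t = μ s := by simp [μ', hst.symm]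
    have hΔ := Phi_sub Pm n0 w q ξ1 ξ2 θ g gc h Q μ μ' {s, t} {μ s, μ t}
      (by simp [Set.injOn_pair, hμst])
      (by simp [Set.injOn_pair, hμ's, hμ't, hμst.symm])
      (fun d hd => by
        simp only [Finset.mem_insert, Finset.mem_singleton, not_or] at hd
        simp [μ', hd])
      (by simp) (by simp [hμ's, hμ't])
    rw [Finset.sum_pair hst, Finset.sum_pair hμst] at hΔ
    have hle := hmax μ'
    rcases hstrict with hlt | hlt | hlt <;> linarith
  · rintro ⟨s, n, hn, hs, hc, hstrict⟩
    set μ' : D → K := fun i => if i = s then n else μ i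
    have hμ's : μ' s = n := if_pos rfl
    have hΔ := Phi_sub Pm n0 w q ξ1 ξ2 θ g gc h Q μ μ' {s} {μ s, n}
      (by simp) (by simp)
      (fun d hd => if_neg (by simpa using hd))
      (by simp) (by simp [hμ's])
    rw [Finset.sum_singleton, Finset.sum_pair hn.symm] at hΔ
    have hle := hmax μ'
    rcases hstrict with hlt | hlt <;> linarith
end

section
/- The strategy p*_d = min(P_m, 1/(c·h_d)) is a dominant strategy for D2D pair d in the power control game: for every d ∈ D, every choice of opponents' powers p_i ≥ 0 (i ≠ d), and every own power p with 0 < p ≤ P_m, one has ln(p*_d·g_{d,d}/(n0 + q·g_d + Σ_{i≠d} p_i·g_{i,d})) − c·h_d·p*_d ≥ ln(p·g_{d,d}/(n0 + q·g_d + Σ_{i≠d} p_i·g_{i,d})) − c·h_d·p, with equality if and only if p = p*_d. -/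
open Finset Real

/-- On `(0, P]`, the map `x ↦ log x - a * x` has `min P (1 / a)` as its strict maximizer. -/
theorem log_sub_mul_lt_of_ne_min {P a x : ℝ} (hP : 0 < P) (ha : 0 < a) (hx : 0 < x)
    (hxP : x ≤ P) (hne : x ≠ min P (1 / a)) :
    Real.log x - a * x < Real.log (min P (1 / a)) - a * min P (1 / a) := by
  have hs : 0 < min P (1 / a) := lt_min hP (by positivity)
  have hslope : (x - min P (1 / a)) * (1 - a * min P (1 / a)) ≤ 0 := by
    rcases le_total P (1 / a) with hle | hle
    · rw [min_eq_left hle]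
      have : P * a ≤ 1 := (le_div_iff₀ ha).1 hle
      exact mul_nonpos_of_nonpos_of_nonneg (by linarith) (by linarith)
    · rw [min_eq_right hle, mul_one_div_cancel ha.ne']
      simp
  generalize min P (1 / a) = s at *
  have hlog := Real.log_lt_sub_one_of_pos (div_pos hx hs) (by rwa [ne_eq, div_eq_one_iff_eq hs.ne'])
  rw [Real.log_div hx.ne' hs.ne'] at hlog
  have hbound : x / s ≤ 1 + a * (x - s) := by
    rw [div_le_iff₀ hs]
    linarith
  linarith

/-- the strategy `p*_d = min(P_m, 1/(c·h_d))` is a dominant strategy for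
D2D pair `d` in the power control game: whatever nonnegative powers the opponents use,
it yields a payoff at least as large as any own power `p ∈ (0, P_m]`, with equality iff
`p = p*_d`. -/
theorem dominant_strategy_power_control
    {D : Type*} [Fintype D] [DecidableEq D] [Nonempty D]
    (n0 q Pm c : ℝ) (g : D → D → ℝ) (gcu : D → ℝ) (h : D → ℝ)
    (hn0 : 0 < n0) (hq : 0 ≤ q) (hPm : 0 < Pm) (hc : 0 < c)
    (hgcu : ∀ d, 0 ≤ gcu d) (hgdiag : ∀ d, 0 < g d d)
    (hgcross : ∀ i d, i ≠ d → 0 ≤ g i d) (hh : ∀ d, 0 < h d)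
    (d : D) (p : D → ℝ) (hp : ∀ i, i ≠ d → 0 ≤ p i) :
    ∀ pow : ℝ, 0 < pow → pow ≤ Pm →
      (Real.log (min Pm (1 / (c * h d)) * g d d /
            (n0 + q * gcu d + ∑ i ∈ univ.filter (fun i => i ≠ d), p i * g i d)) -
          c * h d * min Pm (1 / (c * h d)) ≥
        Real.log (pow * g d d /
            (n0 + q * gcu d + ∑ i ∈ univ.filter (fun i => i ≠ d), p i * g i d)) -
          c * h d * pow) ∧
      (Real.log (min Pm (1 / (c * h d)) * g d d /
            (n0 + q * gcu d + ∑ i ∈ univ.filter (fun i => i ≠ d), p i * g i d)) -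
          c * h d * min Pm (1 / (c * h d)) =
        Real.log (pow * g d d /
            (n0 + q * gcu d + ∑ i ∈ univ.filter (fun i => i ≠ d), p i * g i d)) -
          c * h d * pow ↔
        pow = min Pm (1 / (c * h d))) := by
  intro pow hpow hpowPm
  have ha : 0 < c * h d := mul_pos hc (hh d)
  have hsum : 0 ≤ ∑ i ∈ univ.filter (fun i => i ≠ d), p i * g i d :=
    Finset.sum_nonneg fun i hi =>
      have hid : i ≠ d := (Finset.mem_filter.1 hi).2
      mul_nonneg (hp i hid) (hgcross i d hid)
  have hden : 0 < n0 + q * gcu d + ∑ i ∈ univ.filter (fun i => i ≠ d), p i * g i d := by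
    have := mul_nonneg hq (hgcu d)
    linarith
  have hs : 0 < min Pm (1 / (c * h d)) := lt_min hPm (by positivity)
  have hgain := div_pos (hgdiag d) hden
  rw [mul_div_assoc, mul_div_assoc, Real.log_mul hs.ne' hgain.ne',
    Real.log_mul hpow.ne' hgain.ne']
  by_cases heq : pow = min Pm (1 / (c * h d))
  · rw [← heq]
    exact ⟨le_rfl, fun _ => rfl, fun _ => rfl⟩
  · have hlt := log_sub_mul_lt_of_ne_min hPm ha hpow hpowPm heq
    exact ⟨by linarith, fun hpay => by linarith, fun hpow_eq => absurd hpow_eq heq⟩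
end

section
/- Theorem 2: the power profile p* with p*_d = min(P_m, 1/(c·h_d)) for every d ∈ D is a Nash equilibrium of the power control game: each p*_d lies in (0, P_m], and for every d ∈ D and every p with 0 < p ≤ P_m, R_d(p*) ≥ R_d(p, p*_{−d}), where (p, p*_{−d}) denotes the profile in which pair d uses power p and every other pair i uses power p*_i. -/
open Finset Real

/-- Payoff of D2D pair `d` in the power control game on a single channel:
`R_d(p) = ln(γ_d(p)) − c·h_d·p_d`, where
`γ_d(p) = p_d·g_{d,d}/(n0 + q·g_d + Σ_{i≠d} p_i·g_{i,d})`. -/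
noncomputable def payoff {D : Type*} [Fintype D] [DecidableEq D]
    (n0 q c : ℝ) (g : D → D → ℝ) (gcu : D → ℝ) (h : D → ℝ)
    (p : D → ℝ) (d : D) : ℝ :=
  Real.log (p d * g d d /
      (n0 + q * gcu d + ∑ i ∈ univ.filter (fun i => i ≠ d), p i * g i d)) -
    c * h d * p d

/-- On `(0, M]`, the function `x ↦ log x - a * x` is maximised at `min M (1 / a)`. -/
theorem log_sub_mul_le_at_min {a M p : ℝ} (ha : 0 < a) (hp : 0 < p) (hpM : p ≤ M) :
    Real.log p - a * p ≤ Real.log (min M (1 / a)) - a * min M (1 / a) := by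
  have hs : 0 < min M (1 / a) := lt_min (hp.trans_le hpM) (by positivity)
  have hlog := Real.log_le_sub_one_of_pos (div_pos hp hs)
  rw [Real.log_div hp.ne' hs.ne'] at hlog
  suffices p / min M (1 / a) - 1 ≤ a * (p - min M (1 / a)) by linarith
  rcases le_total M (1 / a) with hM | hM
  · rw [min_eq_left hM]
    have hM0 : 0 < M := hp.trans_le hpM
    have haM : a * M ≤ 1 := by rwa [le_div_iff₀ ha, mul_comm] at hM
    rw [div_sub_one hM0.ne', div_le_iff₀ hM0]
    nlinarith [mul_nonneg (sub_nonneg.2 hpM) (sub_nonneg.2 haM)]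
  · rw [min_eq_right hM]
    apply le_of_eq
    field_simp

/-- Theorem 2 of the paper: the profile `p*` with
`p*_d = min(P_m, 1/(c·h_d))` is a Nash equilibrium of the power control game. -/
theorem power_control_nash_equilibrium
    {D : Type*} [Fintype D] [DecidableEq D] [Nonempty D]
    (n0 q Pm c : ℝ) (g : D → D → ℝ) (gcu : D → ℝ) (h : D → ℝ)
    (hn0 : 0 < n0) (hq : 0 ≤ q) (hPm : 0 < Pm) (hc : 0 < c)
    (hgcu : ∀ d, 0 ≤ gcu d) (hgdiag : ∀ d, 0 < g d d)
    (hgcross : ∀ i d, i ≠ d → 0 ≤ g i d) (hh : ∀ d, 0 < h d) :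
    (∀ d : D, 0 < min Pm (1 / (c * h d)) ∧ min Pm (1 / (c * h d)) ≤ Pm) ∧
    (∀ d : D, ∀ p : ℝ, 0 < p → p ≤ Pm →
      payoff n0 q c g gcu h (fun i => min Pm (1 / (c * h i))) d ≥
        payoff n0 q c g gcu h
          (Function.update (fun i => min Pm (1 / (c * h i))) d p) d) := by
  have hpos : ∀ d, 0 < min Pm (1 / (c * h d)) := fun d =>
    lt_min hPm (one_div_pos.2 (mul_pos hc (hh d)))
  refine ⟨fun d => ⟨hpos d, min_le_left _ _⟩, fun d p hp hpM => ?_⟩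
  have hsum : ∑ i ∈ univ.filter (fun i => i ≠ d),
      Function.update (fun i => min Pm (1 / (c * h i))) d p i * g i d =
      ∑ i ∈ univ.filter (fun i => i ≠ d), min Pm (1 / (c * h i)) * g i d :=
    Finset.sum_congr rfl fun i hi => by
      rw [Function.update_of_ne (Finset.mem_filter.1 hi).2]
  have hI : 0 < n0 + q * gcu d +
      ∑ i ∈ univ.filter (fun i => i ≠ d), min Pm (1 / (c * h i)) * g i d :=
    add_pos_of_pos_of_nonneg (add_pos_of_pos_of_nonneg hn0 (mul_nonneg hq (hgcu d)))
      (Finset.sum_nonneg fun i hi =>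
        mul_nonneg (hpos i).le (hgcross i d (Finset.mem_filter.1 hi).2))
  have hgd := hgdiag d
  have hs := hpos d
  simp only [payoff, hsum, Function.update_self]
  rw [Real.log_div (mul_pos hs hgd).ne' hI.ne', Real.log_div (mul_pos hp hgd).ne' hI.ne',
    Real.log_mul hs.ne' hgd.ne', Real.log_mul hp.ne' hgd.ne']
  linarith [log_sub_mul_le_at_min (mul_pos hc (hh d)) hp hpM]
end

section
/- The Nash equilibrium of the power control game is unique: if p̂ = (p̂_d)_{d∈D} is a profile with 0 < p̂_d ≤ P_m for all d such that for every d ∈ D and every p with 0 < p ≤ P_m one has R_d(p̂) ≥ R_d(p, p̂_{−d}) (where (p, p̂_{−d}) denotes the profile in which pair d uses power p and every other pair i uses p̂_i), then p̂_d = min(P_m, 1/(c·h_d)) for every d ∈ D. -/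
open Finset Real

/-- Deviating to power `x` leaves the interference seen by pair `d` unchanged, so the payoff
splits into `ln x - c·h_d·x` and a constant independent of `x`. -/
lemma payoff_update_eq {D : Type*} [Fintype D] [DecidableEq D]
    (n0 q c : ℝ) (g : D → D → ℝ) (gcu h p : D → ℝ) (d : D) {x : ℝ} (hx : x ≠ 0)
    (hg : g d d ≠ 0)
    (hI : n0 + q * gcu d + ∑ i ∈ univ.filter (fun i => i ≠ d), p i * g i d ≠ 0) :
    payoff n0 q c g gcu h (Function.update p d x) d =
      Real.log x - c * h d * x + (Real.log (g d d) -
        Real.log (n0 + q * gcu d + ∑ i ∈ univ.filter (fun i => i ≠ d), p i * g i d)) := by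
  have hsum : ∑ i ∈ univ.filter (fun i => i ≠ d), Function.update p d x i * g i d =
      ∑ i ∈ univ.filter (fun i => i ≠ d), p i * g i d :=
    Finset.sum_congr rfl fun i hi => by
      rw [Function.update_of_ne (Finset.mem_filter.mp hi).2]
  rw [payoff, hsum, Function.update_self, Real.log_div (mul_ne_zero hx hg) hI,
    Real.log_mul hx hg]
  ring

/-- The only point of `(0, M]` at which `ln x - a·x` can be at least its value at
`min M (1 / a)` is `min M (1 / a)` itself. -/
lemma eq_min_of_log_sub_mul_le {a M x : ℝ} (ha : 0 < a) (hM : 0 < M) (hx : 0 < x)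
    (hxM : x ≤ M)
    (hle : Real.log (min M (1 / a)) - a * min M (1 / a) ≤ Real.log x - a * x) :
    x = min M (1 / a) := by
  by_contra hne
  have hm : 0 < min M (1 / a) := lt_min hM (by positivity)
  have ham : a * min M (1 / a) ≤ 1 := by
    rw [mul_comm, ← le_div_iff₀ ha]
    exact min_le_right _ _
  have hcase : min M (1 / a) = M ∨ a * min M (1 / a) = 1 := by
    rcases min_choice M (1 / a) with h | h
    · exact Or.inl h
    · right
      rw [h]
      field_simp
  generalize min M (1 / a) = m at *
  have hlog : Real.log x - Real.log m < x / m - 1 := by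
    rw [← Real.log_div hx.ne' hm.ne']
    exact Real.log_lt_sub_one_of_pos (div_pos hx hm) fun h => hne ((div_eq_one_iff_eq hm.ne').mp h)
  have hlt : a * (x - m) < x / m - 1 := by linarith
  rw [div_sub_one hm.ne', lt_div_iff₀ hm] at hlt
  rcases hcase with h | h
  · subst h
    nlinarith
  · have : a * (x - m) * m = x - m := by linear_combination (x - m) * h
    linarith

/-- uniqueness of the Nash equilibrium of the power control game:
any profile `p̂` with `0 < p̂_d ≤ P_m` for all `d` from which no player can profitably
deviate must satisfy `p̂_d = min(P_m, 1/(c·h_d))` for every `d`. -/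
theorem power_control_nash_equilibrium_unique
    {D : Type*} [Fintype D] [DecidableEq D] [Nonempty D]
    (n0 q Pm c : ℝ) (g : D → D → ℝ) (gcu : D → ℝ) (h : D → ℝ)
    (hn0 : 0 < n0) (hq : 0 ≤ q) (hPm : 0 < Pm) (hc : 0 < c)
    (hgcu : ∀ d, 0 ≤ gcu d) (hgdiag : ∀ d, 0 < g d d)
    (hgcross : ∀ i d, i ≠ d → 0 ≤ g i d) (hh : ∀ d, 0 < h d)
    (phat : D → ℝ) (hphat : ∀ d, 0 < phat d ∧ phat d ≤ Pm)
    (hNE : ∀ d : D, ∀ p : ℝ, 0 < p → p ≤ Pm →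
      payoff n0 q c g gcu h phat d ≥
        payoff n0 q c g gcu h (Function.update phat d p) d) :
    ∀ d : D, phat d = min Pm (1 / (c * h d)) := by
  intro d
  obtain ⟨hx, hxM⟩ := hphat d
  have ha : 0 < c * h d := mul_pos hc (hh d)
  have hm : 0 < min Pm (1 / (c * h d)) := lt_min hPm (by positivity)
  have hI : 0 < n0 + q * gcu d + ∑ i ∈ univ.filter (fun i => i ≠ d), phat i * g i d := by
    have hcu : 0 ≤ q * gcu d := mul_nonneg hq (hgcu d)
    have hsum : 0 ≤ ∑ i ∈ univ.filter (fun i => i ≠ d), phat i * g i d :=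
      Finset.sum_nonneg fun i hi =>
        mul_nonneg (hphat i).1.le (hgcross i d (Finset.mem_filter.mp hi).2)
    linarith
  refine eq_min_of_log_sub_mul_le ha hPm hx hxM ?_
  have hdev := hNE d _ hm (min_le_left _ _)
  have hself := payoff_update_eq n0 q c g gcu h phat d hx.ne' (hgdiag d).ne' hI.ne'
  rw [Function.update_eq_self] at hself
  rw [hself, payoff_update_eq n0 q c g gcu h phat d hm.ne' (hgdiag d).ne' hI.ne'] at hdev
  linarith
end

section
/- Theorem 3 (Pareto optimality of tight power profiles): let p = (p_d)_{d∈D} be a power profile with p_d ≥ 0 for all d and Σ_{d∈D} p_d·h_d = Q. Then p is Pareto optimal: there exists no power profile p' = (p'_d)_{d∈D} with p'_d ≥ 0 for all d and Σ_{d∈D} p'_d·h_d ≤ Q such that γ_d(p') ≥ γ_d(p) for every d ∈ D and γ_d(p') > γ_d(p) for at least one d ∈ D. -/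
open Finset Real

/-- SINR of D2D pair `d` under power profile `p` on a single shared channel:
`γ_d(p) = p_d·g_{d,d}/(n0 + q·g_d + Σ_{i≠d} p_i·g_{i,d})`. -/
noncomputable def sinr {D : Type*} [Fintype D] [DecidableEq D]
    (n0 q : ℝ) (g : D → D → ℝ) (gcu : D → ℝ) (p : D → ℝ) (d : D) : ℝ :=
  p d * g d d / (n0 + q * gcu d + ∑ i ∈ univ.filter (fun i => i ≠ d), p i * g i d)

/-- SINR vectors are inverse-monotone: if every pair has at least the SINR under `p'` that it has
under `p`, then `p ≤ p'` componentwise. -/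
theorem le_of_forall_sinr_le {D : Type*} [Fintype D] [DecidableEq D]
    {n0 q : ℝ} {g : D → D → ℝ} {gcu : D → ℝ}
    (hn0 : 0 < n0) (hq : 0 ≤ q) (hgcu : ∀ d, 0 ≤ gcu d) (hgdiag : ∀ d, 0 < g d d)
    (hgcross : ∀ i d, i ≠ d → 0 ≤ g i d)
    {p p' : D → ℝ} (hp : ∀ d, 0 ≤ p d) (hp' : ∀ d, 0 ≤ p' d)
    (hle : ∀ d, sinr n0 q g gcu p d ≤ sinr n0 q g gcu p' d) : p ≤ p' := by
  by_contra hnot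
  obtain ⟨e, he⟩ : ∃ e, p' e < p e := by simpa [Pi.le_def] using hnot
  have hpe : 0 < p e := (hp' e).trans_lt he
  obtain ⟨d, hd, hmin⟩ := exists_min_image (univ.filter fun i => 0 < p i) (fun i => p' i / p i)
    ⟨e, by simpa using hpe⟩
  replace hd : 0 < p d := by simpa using hd
  set α := p' d / p d
  have hα_lt : α < 1 := (hmin e (by simpa using hpe)).trans_lt ((div_lt_one hpe).2 he)
  have hscale (i : D) : α * p i ≤ p' i := by
    rcases (hp i).eq_or_lt with hi | hi
    · simpa [← hi] using hp' i
    · exact (le_div_iff₀ hi).1 (hmin i (by simpa using hi))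
  have hnonneg {r : D → ℝ} (hr : ∀ i, 0 ≤ r i) :
      0 ≤ ∑ i ∈ univ.filter (fun i => i ≠ d), r i * g i d :=
    sum_nonneg fun i hi => mul_nonneg (hr i) (hgcross i d (by simpa using hi))
  have hI := hnonneg hp
  have hI' := hnonneg hp'
  have hinterf : α * ∑ i ∈ univ.filter (fun i => i ≠ d), p i * g i d
      ≤ ∑ i ∈ univ.filter (fun i => i ≠ d), p' i * g i d := by
    rw [mul_sum]
    refine sum_le_sum fun i hi => ?_
    rw [← mul_assoc]
    exact mul_le_mul_of_nonneg_right (hscale i) (hgcross i d (by simpa using hi))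
  have hN : 0 < n0 + q * gcu d := add_pos_of_pos_of_nonneg hn0 (mul_nonneg hq (hgcu d))
  have hsinr := hle d
  rw [sinr, sinr, div_le_div_iff₀ (by linarith) (by linarith),
    show p' d = α * p d from (div_mul_cancel₀ _ hd.ne').symm] at hsinr
  have hbound : n0 + q * gcu d + ∑ i ∈ univ.filter (fun i => i ≠ d), p' i * g i d
      ≤ α * (n0 + q * gcu d + ∑ i ∈ univ.filter (fun i => i ≠ d), p i * g i d) :=
    le_of_mul_le_mul_left (by linarith) (mul_pos hd (hgdiag d))
  nlinarith

/-- Theorem 3 of the paper: any power profile that makes the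
interference constraint tight, `Σ_d p_d·h_d = Q`, is Pareto optimal. -/
theorem tight_power_profile_pareto_optimal
    {D : Type*} [Fintype D] [DecidableEq D] [Nonempty D]
    (n0 q Q : ℝ) (g : D → D → ℝ) (gcu : D → ℝ) (h : D → ℝ)
    (hn0 : 0 < n0) (hq : 0 ≤ q) (hQ : 0 < Q)
    (hgcu : ∀ d, 0 ≤ gcu d) (hgdiag : ∀ d, 0 < g d d)
    (hgcross : ∀ i d, i ≠ d → 0 ≤ g i d) (hh : ∀ d, 0 < h d)
    (p : D → ℝ) (hp : ∀ d, 0 ≤ p d) (htight : ∑ d : D, p d * h d = Q) :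
    ¬ ∃ p' : D → ℝ, (∀ d, 0 ≤ p' d) ∧ (∑ d : D, p' d * h d ≤ Q) ∧
        (∀ d : D, sinr n0 q g gcu p' d ≥ sinr n0 q g gcu p d) ∧
        (∃ d : D, sinr n0 q g gcu p' d > sinr n0 q g gcu p d) := by
  rintro ⟨p', hp', hsum, hge, d, hd⟩
  have hle : p ≤ p' := le_of_forall_sinr_le hn0 hq hgcu hgdiag hgcross hp hp' hge
  have hterm (i : D) : p i * h i ≤ p' i * h i := mul_le_mul_of_nonneg_right (hle i) (hh i).le
  have hsum_eq : ∑ i, p i * h i = ∑ i, p' i * h i :=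
    le_antisymm (sum_le_sum fun i _ => hterm i) (hsum.trans htight.ge)
  have heq : p = p' := funext fun i => mul_right_cancel₀ (hh i).ne'
    ((sum_eq_sum_iff_of_le fun i _ => hterm i).1 hsum_eq i (mem_univ i))
  exact hd.ne' (by rw [heq])
end

section
/- If 0 < Q < Σ_{d∈D} P_m·h_d, then there exists a virtual price factor c* > 0 such that F(c*) = Q, i.e. the equilibrium powers p_d = min(P_m, 1/(c*·h_d)) make the interference constraint tight: Σ_{d∈D} p_d·h_d = Q. -/
open Finset Real

/-- if `0 < Q < Σ_d P_m·h_d`, then there exists a virtual price factor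
`c* > 0` whose equilibrium powers `p_d = min(P_m, 1/(c*·h_d))` make the interference
constraint tight: `Σ_d p_d·h_d = Q`. -/
theorem exists_price_making_interference_tight
    {D : Type*} [Fintype D] [Nonempty D]
    (Pm Q : ℝ) (h : D → ℝ) (hPm : 0 < Pm) (hh : ∀ d, 0 < h d)
    (hQpos : 0 < Q) (hQlt : Q < ∑ d : D, Pm * h d) :
    ∃ cstar : ℝ, 0 < cstar ∧
      ∑ d : D, min Pm (1 / (cstar * h d)) * h d = Q := by
  have hcap : ∀ d, 0 < Pm * h d := fun d => mul_pos hPm (hh d)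
  set T := ∑ d : D, Pm * h d
  have hle : ∀ d, Pm * h d ≤ T := fun d =>
    Finset.single_le_sum (f := fun d => Pm * h d) (fun i _ => (hcap i).le) (Finset.mem_univ d)
  let G : ℝ → ℝ := fun t => ∑ d : D, min (Pm * h d) t
  have hG : Continuous G := by fun_prop
  have hG0 : G 0 = 0 := Finset.sum_eq_zero fun d _ => min_eq_right (hcap d).le
  have hGT : G T = T := Finset.sum_congr rfl fun d _ => min_eq_left (hle d)
  obtain ⟨t, ⟨ht0, -⟩, htQ⟩ := intermediate_value_Icc (hQpos.trans hQlt).le hG.continuousOn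
    (show Q ∈ Set.Icc (G 0) (G T) from ⟨hG0.trans_le hQpos.le, hQlt.le.trans_eq hGT.symm⟩)
  have ht : 0 < t := ht0.lt_of_ne (by rintro rfl; exact hQpos.ne (hG0.symm.trans htQ))
  refine ⟨t⁻¹, inv_pos.mpr ht, htQ ▸ Finset.sum_congr rfl fun d _ => ?_⟩
  have hd := (hh d).ne'
  rw [min_mul_of_nonneg _ _ (hh d).le]
  congr 1
  field_simp
end

section
/- If 0 < Q < Σ_{d∈D} P_m·h_d, then there exists a virtual price factor c* > 0 such that the equilibrium power profile p with p_d = min(P_m, 1/(c*·h_d)) satisfies Σ_{d∈D} p_d·h_d = Q and is Pareto optimal: there exists no power profile p' = (p'_d)_{d∈D} with p'_d ≥ 0 for all d and Σ_{d∈D} p'_d·h_d ≤ Q such that γ_d(p') ≥ γ_d(p) for every d ∈ D and γ_d(p') > γ_d(p) for at least one d ∈ D. -/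
open Finset Real

/-- Without a power budget, a profile that weakly improves every SINR of a positive profile
uses at least as much power on every pair. -/
theorem le_of_sinr_le {D : Type*} [Fintype D] [DecidableEq D]
    {n0 q : ℝ} {g : D → D → ℝ} {gcu : D → ℝ} {p p' : D → ℝ}
    (hn0 : 0 < n0) (hq : 0 ≤ q) (hgcu : ∀ d, 0 ≤ gcu d) (hgdiag : ∀ d, 0 < g d d)
    (hgcross : ∀ i d, i ≠ d → 0 ≤ g i d) (hp : ∀ d, 0 < p d) (hp' : ∀ d, 0 ≤ p' d)
    (hle : ∀ d, sinr n0 q g gcu p d ≤ sinr n0 q g gcu p' d) (d : D) : p d ≤ p' d := by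
  have : Nonempty D := ⟨d⟩
  obtain ⟨m, hm⟩ := Finite.exists_min (fun d => p' d / p d)
  set t := p' m / p m with ht
  have hscale : ∀ i, t * p i ≤ p' i := fun i => (le_div_iff₀ (hp i)).1 (hm i)
  suffices h1 : 1 ≤ t by nlinarith [hscale d, hp d]
  by_contra! hlt
  have hN : 0 < n0 + q * gcu m := by nlinarith [mul_nonneg hq (hgcu m)]
  have hpm : p' m = t * p m := by rw [ht, div_mul_cancel₀ _ (hp m).ne']
  have hcross : ∀ i ∈ univ.filter (fun i => i ≠ m), 0 ≤ g i m := fun i hi =>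
    hgcross i m (Finset.mem_filter.1 hi).2
  have hJ : 0 ≤ ∑ i ∈ univ.filter (fun i => i ≠ m), p i * g i m :=
    Finset.sum_nonneg fun i hi => mul_nonneg (hp i).le (hcross i hi)
  have hJ' : 0 ≤ ∑ i ∈ univ.filter (fun i => i ≠ m), p' i * g i m :=
    Finset.sum_nonneg fun i hi => mul_nonneg (hp' i) (hcross i hi)
  have hJJ' : t * ∑ i ∈ univ.filter (fun i => i ≠ m), p i * g i m ≤
      ∑ i ∈ univ.filter (fun i => i ≠ m), p' i * g i m := by
    rw [Finset.mul_sum]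
    refine Finset.sum_le_sum fun i hi => ?_
    rw [← mul_assoc]
    exact mul_le_mul_of_nonneg_right (hscale i) (hcross i hi)
  have hm' := hle m
  unfold sinr at hm'
  rw [div_le_div_iff₀ (by linarith) (by linarith), hpm] at hm'
  have hpos : 0 < p m * g m m := mul_pos (hp m) (hgdiag m)
  have key := le_of_mul_le_mul_left (hm'.trans_eq (by ring :
    _ = p m * g m m * (t * (n0 + q * gcu m +
      ∑ i ∈ univ.filter (fun i => i ≠ m), p i * g i m)))) hpos
  nlinarith [mul_pos (sub_pos.2 hlt) hN]

/-- The aggregate interference at the base station takes every value between zero and its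
full-power value as the price factor varies. -/
theorem exists_price_sum_eq {D : Type*} [Fintype D] {Pm Q : ℝ} {h : D → ℝ}
    (hPm : 0 < Pm) (hQpos : 0 < Q) (hh : ∀ d, 0 < h d) (hQlt : Q < ∑ d : D, Pm * h d) :
    ∃ c : ℝ, 0 < c ∧ ∑ d : D, min Pm (1 / (c * h d)) * h d = Q := by
  have hcont : Continuous fun s : ℝ => ∑ d : D, min Pm (s / h d) * h d := by fun_prop
  have hS : 0 ≤ ∑ d : D, Pm * h d := (hQpos.trans hQlt).le
  have h0 : ∑ d : D, min Pm (0 / h d) * h d = 0 := by simp [hPm.le]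
  have h1 : ∑ d : D, min Pm ((∑ e : D, Pm * h e) / h d) * h d = ∑ d : D, Pm * h d := by
    refine Finset.sum_congr rfl fun d _ => ?_
    rw [min_eq_left]
    rw [le_div_iff₀ (hh d)]
    exact Finset.single_le_sum (f := fun e => Pm * h e)
      (fun e _ => (mul_pos hPm (hh e)).le) (Finset.mem_univ d)
  obtain ⟨s, ⟨hs, -⟩, hsQ⟩ := intermediate_value_Icc hS hcont.continuousOn
    (show Q ∈ Set.Icc _ _ from ⟨h0.trans_le hQpos.le, hQlt.le.trans_eq h1.symm⟩)
  have hspos : 0 < s := by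
    refine hs.lt_of_ne fun h => hQpos.ne ?_
    subst h
    exact h0.symm.trans hsQ
  refine ⟨s⁻¹, inv_pos.2 hspos, hsQ ▸ Finset.sum_congr rfl fun d _ => ?_⟩
  rw [one_div, mul_inv, inv_inv, div_eq_mul_inv]

/-- if `0 < Q < Σ_d P_m·h_d`, then there exists a virtual price factor
`c* > 0` such that the equilibrium power profile `p_d = min(P_m, 1/(c*·h_d))` makes
the interference constraint tight and is Pareto optimal. -/
theorem exists_price_equilibrium_pareto_optimal
    {D : Type*} [Fintype D] [DecidableEq D] [Nonempty D]
    (n0 q Pm Q : ℝ) (g : D → D → ℝ) (gcu : D → ℝ) (h : D → ℝ)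
    (hn0 : 0 < n0) (hq : 0 ≤ q) (hPm : 0 < Pm) (hQpos : 0 < Q)
    (hgcu : ∀ d, 0 ≤ gcu d) (hgdiag : ∀ d, 0 < g d d)
    (hgcross : ∀ i d, i ≠ d → 0 ≤ g i d) (hh : ∀ d, 0 < h d)
    (hQlt : Q < ∑ d : D, Pm * h d) :
    ∃ cstar : ℝ, 0 < cstar ∧
      (∑ d : D, min Pm (1 / (cstar * h d)) * h d = Q) ∧
      ¬ ∃ p' : D → ℝ, (∀ d, 0 ≤ p' d) ∧ (∑ d : D, p' d * h d ≤ Q) ∧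
          (∀ d : D, sinr n0 q g gcu p' d ≥
            sinr n0 q g gcu (fun i => min Pm (1 / (cstar * h i))) d) ∧
          (∃ d : D, sinr n0 q g gcu p' d >
            sinr n0 q g gcu (fun i => min Pm (1 / (cstar * h i))) d) := by
  obtain ⟨c, hc, hsum⟩ := exists_price_sum_eq hPm hQpos hh hQlt
  refine ⟨c, hc, hsum, ?_⟩
  rintro ⟨p', hp', hbudget, hge, d, hgt⟩
  have hp : ∀ i, 0 < min Pm (1 / (c * h i)) := fun i =>
    lt_min hPm (one_div_pos.2 (mul_pos hc (hh i)))
  have hle := le_of_sinr_le hn0 hq hgcu hgdiag hgcross hp hp' hge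
  have hterm : ∀ i ∈ univ, min Pm (1 / (c * h i)) * h i ≤ p' i * h i := fun i _ =>
    mul_le_mul_of_nonneg_right (hle i) (hh i).le
  have heq := (Finset.sum_eq_sum_iff_of_le hterm).1
    (le_antisymm (Finset.sum_le_sum hterm) (hbudget.trans_eq hsum.symm))
  have hpp' : p' = fun i => min Pm (1 / (c * h i)) := funext fun i =>
    (mul_right_cancel₀ (hh i).ne' (heq i (Finset.mem_univ i))).symm
  rw [hpp'] at hgt
  exact lt_irrefl _ hgt
end
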